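/- Let n ≥ 2 be an integer and δ > 0 a real number, and define ε_δ(r) = 1 − n·cs_δ(r)·sn_δ(r)^{−n}·∫₀^r sn_δ(t)^{n−1} dt. Then ε_δ is nondecreasing on the interval (0, π/√δ). (This monotonicity is established in Case (ii) of the proof of Proposition 2.4 of the paper via the identity ε_δ'(r) = (n/(n−1))·α_δ''(r) and convexity of α_δ.) -/

import Mathlib

open Real intervalIntegral

/-- `sn_δ` from the paper. -/
noncomputable def snDelta (δ t : ℝ) : ℝ :=
  if 0 < δ then Real.sin (Real.sqrt δ * t) / Real.sqrt δ
  else if δ = 0 then t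
  else Real.sinh (Real.sqrt (-δ) * t) / Real.sqrt (-δ)

/-- `cs_δ`, the derivative of `sn_δ`. -/
noncomputable def csDelta (δ t : ℝ) : ℝ :=
  if 0 < δ then Real.cos (Real.sqrt δ * t)
  else if δ = 0 then 1
  else Real.cosh (Real.sqrt (-δ) * t)

theorem hasDerivAt_snDelta {δ : ℝ} (hδ : 0 < δ) (t : ℝ) :
    HasDerivAt (snDelta δ) (csDelta δ t) t := by
  have h0 : √δ ≠ 0 := (Real.sqrt_pos.2 hδ).ne'
  have h : HasDerivAt (fun t => Real.sin (√δ * t) / √δ)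
      (Real.cos (√δ * t) * (√δ * 1) / √δ) t :=
    (((hasDerivAt_id t).const_mul √δ).sin).div_const √δ
  have hs : snDelta δ = fun t => Real.sin (√δ * t) / √δ := by
    funext t; simp [snDelta, hδ]
  rw [hs]
  convert h using 1
  simp only [csDelta, hδ, if_true]
  field_simp

theorem hasDerivAt_csDelta {δ : ℝ} (hδ : 0 < δ) (t : ℝ) :
    HasDerivAt (csDelta δ) (-(δ * snDelta δ t)) t := by
  have h0 : √δ ≠ 0 := (Real.sqrt_pos.2 hδ).ne'
  have h : HasDerivAt (fun t => Real.cos (√δ * t)) (-Real.sin (√δ * t) * (√δ * 1)) t :=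
    ((hasDerivAt_id t).const_mul √δ).cos
  have hc : csDelta δ = fun t => Real.cos (√δ * t) := by
    funext t; simp [csDelta, hδ]
  rw [hc]
  convert h using 1
  simp only [snDelta, hδ, if_true]
  field_simp
  rw [Real.sq_sqrt hδ.le]

theorem csDelta_sq_add {δ : ℝ} (hδ : 0 < δ) (t : ℝ) :
    csDelta δ t ^ 2 + δ * snDelta δ t ^ 2 = 1 := by
  simp only [csDelta, snDelta, hδ, if_true]
  rw [div_pow, Real.sq_sqrt hδ.le, mul_div_cancel₀ _ hδ.ne', Real.cos_sq_add_sin_sq]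

theorem snDelta_zero (δ : ℝ) : snDelta δ 0 = 0 := by
  simp [snDelta]

theorem snDelta_pos {δ : ℝ} (hδ : 0 < δ) {t : ℝ} (ht : t ∈ Set.Ioo 0 (Real.pi / √δ)) :
    0 < snDelta δ t := by
  have h0 : 0 < √δ := Real.sqrt_pos.2 hδ
  simp only [snDelta, hδ, if_true]
  refine div_pos (Real.sin_pos_of_pos_of_lt_pi (mul_pos h0 ht.1) ?_) h0
  rw [mul_comm]
  exact (lt_div_iff₀ h0).1 ht.2

theorem hasDerivAt_integral_snDelta_pow {δ : ℝ} (hδ : 0 < δ) (m : ℕ) (r : ℝ) :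
    HasDerivAt (fun r => ∫ t in (0 : ℝ)..r, snDelta δ t ^ m) (snDelta δ r ^ m) r := by
  have hc : Continuous fun t => snDelta δ t ^ m :=
    (continuous_iff_continuousAt.2 fun t => (hasDerivAt_snDelta hδ t).continuousAt).pow m
  exact hc.integral_hasStrictDerivAt 0 r |>.hasDerivAt

/-- A lower bound for `∫₀^r sn_δ^m`, obtained by comparing derivatives. -/
theorem csDelta_mul_snDelta_pow_le_integral {δ : ℝ} (hδ : 0 < δ) (m : ℕ) {r : ℝ}
    (hr : r ∈ Set.Ioo 0 (Real.pi / √δ)) :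
    csDelta δ r * snDelta δ r ^ (m + 1) ≤
      (1 + m * csDelta δ r ^ 2) * ∫ t in (0 : ℝ)..r, snDelta δ t ^ m := by
  have hD (t : ℝ) : 0 < 1 + m * csDelta δ t ^ 2 := by positivity
  have hG (t : ℝ) : HasDerivAt
      (fun r => (∫ t in (0 : ℝ)..r, snDelta δ t ^ m) -
        csDelta δ r * snDelta δ r ^ (m + 1) / (1 + m * csDelta δ r ^ 2))
      (2 * δ * snDelta δ t ^ (m + 2) / (1 + m * csDelta δ t ^ 2) ^ 2) t := by
    have hs := hasDerivAt_snDelta hδ t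
    have hc := hasDerivAt_csDelta hδ t
    refine ((hasDerivAt_integral_snDelta_pow hδ m t).sub ((hc.mul (hs.pow (m + 1))).div
      (((hc.pow 2).const_mul (m : ℝ)).const_add 1) (hD t).ne')).congr_deriv ?_
    have hD' := (hD t).ne'
    have h1 : csDelta δ t ^ 2 = 1 - δ * snDelta δ t ^ 2 := by
      linarith [csDelta_sq_add hδ t]
    simp only [Pi.mul_apply, Pi.pow_apply, Nat.add_sub_cancel]
    field_simp
    push_cast
    ring_nf
    have h4 : csDelta δ t ^ 4 = (1 - δ * snDelta δ t ^ 2) ^ 2 := by rw [← h1]; ring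
    simp only [h4, h1]
    ring
  have hmono : MonotoneOn
      (fun r => (∫ t in (0 : ℝ)..r, snDelta δ t ^ m) -
        csDelta δ r * snDelta δ r ^ (m + 1) / (1 + m * csDelta δ r ^ 2))
      (Set.Icc 0 r) := by
    refine monotoneOn_of_deriv_nonneg (convex_Icc 0 r)
      (fun t _ => (hG t).continuousAt.continuousWithinAt)
      (fun t _ => (hG t).differentiableAt.differentiableWithinAt) fun t ht => ?_
    rw [interior_Icc] at ht
    rw [(hG t).deriv]
    have := snDelta_pos hδ ⟨ht.1, ht.2.trans hr.2⟩
    positivity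
  have h := hmono (Set.left_mem_Icc.2 hr.1.le) (Set.right_mem_Icc.2 hr.1.le) hr.1.le
  simp only [integral_same, snDelta_zero, ne_eq, Nat.add_eq_zero_iff, one_ne_zero, and_false,
    not_false_eq_true, zero_pow, mul_zero, zero_div, sub_zero, sub_nonneg] at h
  rwa [div_le_iff₀' (hD r)] at h

/-- Monotonicity of `ε_δ(r) = 1 − n·cs_δ(r)·sn_δ(r)^{−n}·∫₀^r sn_δ(t)^{n−1} dt`
on `(0, π/√δ)` for `δ > 0`, established in Case (ii) of the proof of
Proposition 2.4 of the paper. -/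
theorem epsDelta_monotoneOn (n : ℕ) (hn : 2 ≤ n) (δ : ℝ) (hδ : 0 < δ) :
    MonotoneOn
      (fun r => 1 - (n : ℝ) * csDelta δ r * (snDelta δ r ^ n)⁻¹ *
        ∫ t in (0:ℝ)..r, snDelta δ t ^ (n - 1))
      (Set.Ioo 0 (Real.pi / Real.sqrt δ)) := by
  obtain ⟨m, rfl⟩ : ∃ m, n = m + 1 := ⟨n - 1, by omega⟩
  simp only [Nat.add_sub_cancel]
  have hf {r : ℝ} (hr : r ∈ Set.Ioo 0 (Real.pi / √δ)) : HasDerivAt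
      (fun r => 1 - ((m + 1 : ℕ) : ℝ) * csDelta δ r * (snDelta δ r ^ (m + 1))⁻¹ *
        ∫ t in (0:ℝ)..r, snDelta δ t ^ m)
      ((m + 1) * ((1 + m * csDelta δ r ^ 2) * (∫ t in (0:ℝ)..r, snDelta δ t ^ m) -
        csDelta δ r * snDelta δ r ^ (m + 1)) / snDelta δ r ^ (m + 2)) r := by
    have hs := hasDerivAt_snDelta hδ r
    have hc := hasDerivAt_csDelta hδ r
    have hpos := (snDelta_pos hδ hr).ne'
    refine ((((hc.const_mul ((m + 1 : ℕ) : ℝ)).mul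
      ((hs.pow (m + 1)).inv (pow_ne_zero _ hpos))).mul
      (hasDerivAt_integral_snDelta_pow hδ m r)).const_sub 1).congr_deriv ?_
    have h1 : csDelta δ r ^ 2 = 1 - δ * snDelta δ r ^ 2 := by
      linarith [csDelta_sq_add hδ r]
    simp only [Pi.mul_apply, Pi.pow_apply, Pi.inv_apply, Nat.add_sub_cancel]
    generalize (∫ t in (0:ℝ)..r, snDelta δ t ^ m) = J
    push_cast
    field_simp
    ring_nf
    simp only [h1]
    ring
  refine monotoneOn_of_deriv_nonneg (convex_Ioo _ _)
    (fun r hr => (hf hr).continuousAt.continuousWithinAt)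
    (fun r hr => (hf (interior_subset hr)).differentiableAt.differentiableWithinAt)
    fun r hr => ?_
  replace hr := interior_subset hr
  rw [(hf hr).deriv]
  have hpos := snDelta_pos hδ hr
  have hle := sub_nonneg.2 (csDelta_mul_snDelta_pow_le_integral hδ m hr)
  positivity
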